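/- Post's Correspondence Problem over the binary alphabet is undecidable: there is no algorithm that, given n ≥ 1 and pairs (a_i, b_i) ∈ {0,1}* × {0,1}* for 1 ≤ i ≤ n, decides whether there exists a nonempty index sequence i_1,…,i_k with a_{i_1}⋯a_{i_k} = b_{i_1}⋯b_{i_k}. -/

import Mathlib

/-- Modal formulas over a set of agents, atoms indexed by ℕ. -/
inductive Form (Agent : Type) : Type
  | falsum : Form Agent
  | atom : ℕ → Form Agent
  | neg : Form Agent → Form Agent
  | conj : Form Agent → Form Agent → Form Agent
  | know : Agent → Form Agent → Form Agent

/-- A Kripke model: accessibility relations and valuation. -/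
structure KripkeModel (Agent : Type) (W : Type) where
  R : Agent → W → W → Prop
  V : W → ℕ → Prop

/-- Satisfaction of a modal formula at a world. -/
def KripkeModel.sat {Agent W : Type} (M : KripkeModel Agent W) : W → Form Agent → Prop
  | _, .falsum => False
  | w, .atom p => M.V w p
  | w, .neg φ => ¬ M.sat w φ
  | w, .conj φ ψ => M.sat w φ ∧ M.sat w ψ
  | w, .know i φ => ∀ v, M.R i w v → M.sat v φ

/-- An event model: pointedless Kripke frame with preconditions on events. -/
structure EventModel (Agent : Type) (E : Type) where
  Q : Agent → E → E → Prop
  pre : E → Form Agent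

/-- The product update of a Kripke model with an event model: worlds are the
pairs surviving the preconditions, accessibility is componentwise, valuation
is inherited. -/
def productModel {Agent W E : Type} (M : KripkeModel Agent W) (A : EventModel Agent E) :
    KripkeModel Agent {p : W × E // M.sat p.1 (A.pre p.2)} where
  R i x y := M.R i x.1.1 y.1.1 ∧ A.Q i x.1.2 y.1.2
  V x n := M.V x.1.1 n

/-- An epistemic state: a pointed Kripke model. -/
structure EpiState (Agent : Type) where
  W : Type
  M : KripkeModel Agent W
  w : W

/-- An epistemic action: a pointed event model. -/
structure EpiAction (Agent : Type) where
  E : Type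
  A : EventModel Agent E
  e : E

/-- An action applies to a state when the designated event's precondition
holds at the designated world. -/
def EpiAction.applies {Agent : Type} (a : EpiAction Agent) (s : EpiState Agent) : Prop :=
  s.M.sat s.w (a.A.pre a.e)

/-- The product update of an epistemic state by an applicable epistemic action. -/
def EpiState.update {Agent : Type} (s : EpiState Agent) (a : EpiAction Agent) (h : a.applies s) :
    EpiState Agent where
  W := {p : s.W × a.E // s.M.sat p.1 (a.A.pre p.2)}
  M := productModel s.M a.A
  w := ⟨(s.w, a.e), h⟩

/-- `Exec s α t` : the sequence of actions `α` applies (left to right) to `s`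
and results in `t`. -/
inductive Exec {Agent : Type} : EpiState Agent → List (EpiAction Agent) → EpiState Agent → Prop
  | nil (s : EpiState Agent) : Exec s [] s
  | snoc {s t : EpiState Agent} {α : List (EpiAction Agent)} (a : EpiAction Agent)
      (hst : Exec s α t) (h : a.applies t) : Exec s (α ++ [a]) (t.update a h)

/-- `Z` is a bisimulation between `M` and `M'`. -/
def Bisim {Agent W W' : Type} (M : KripkeModel Agent W) (M' : KripkeModel Agent W')
    (Z : W → W' → Prop) : Prop :=
  ∀ w w', Z w w' →
    (∀ p, M.V w p ↔ M'.V w' p) ∧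
    (∀ i v, M.R i w v → ∃ v', M'.R i w' v' ∧ Z v v') ∧
    (∀ i v', M'.R i w' v' → ∃ v, M.R i w v ∧ Z v v')

/-- Two pointed models are bisimilar. -/
def Bisimilar {Agent : Type} (s t : EpiState Agent) : Prop :=
  ∃ Z : s.W → t.W → Prop, Bisim s.M t.M Z ∧ Z s.w t.w

/-- A formula is propositional (modal depth 0). -/
def Form.IsProp {Agent : Type} : Form Agent → Prop
  | .falsum => True
  | .atom _ => True
  | .neg φ => φ.IsProp
  | .conj φ ψ => φ.IsProp ∧ ψ.IsProp
  | .know _ _ => False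

/-- Modal depth of a formula. -/
def Form.depth {Agent : Type} : Form Agent → ℕ
  | .falsum => 0
  | .atom _ => 0
  | .neg φ => φ.depth
  | .conj φ ψ => max φ.depth ψ.depth
  | .know _ φ => φ.depth + 1

/-- The submodel of a state induced by a set of worlds containing the point. -/
def EpiState.sub {Agent : Type} (s : EpiState Agent) (S : Set s.W) (h : s.w ∈ S) : EpiState Agent where
  W := S
  M := { R := fun i x y => s.M.R i x.1 y.1, V := fun x n => s.M.V x.1 n }
  w := ⟨s.w, h⟩

namespace PCP

open Relation

/-- A list of dominoes has a match: some nonempty sequence of its dominoes reads the same word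
along both rows. -/
def HasMatch {α : Type*} (T : List (List α × List α)) : Prop :=
  ∃ s : List (List α × List α), s ≠ [] ∧ (∀ t ∈ s, t ∈ T) ∧ s.flatMap Prod.fst = s.flatMap Prod.snd

theorem hasMatch_iff_exists_index {α : Type*} (T : List (List α × List α)) :
    HasMatch T ↔ ∃ idx : List (Fin T.length), idx ≠ [] ∧
      (idx.map fun i => (T.get i).1).flatten = (idx.map fun i => (T.get i).2).flatten := by
  constructor
  · rintro ⟨s, hs, hT, h⟩
    obtain ⟨idx, rfl⟩ : ∃ idx : List (Fin T.length), idx.map T.get = s := by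
      have : s ∈ Set.range (List.map T.get) := by
        rw [Set.range_list_map]
        exact fun t ht => List.mem_iff_get.1 (hT t ht)
      exact this
    refine ⟨idx, by simpa using hs, ?_⟩
    simpa [List.flatMap, Function.comp_def] using h
  · rintro ⟨idx, hne, h⟩
    refine ⟨idx.map T.get, by simpa using hne, ?_, ?_⟩
    · intro t ht
      obtain ⟨i, -, rfl⟩ := List.mem_map.1 ht
      exact List.get_mem _ _
    · simpa [List.flatMap, Function.comp_def] using h

theorem hasMatch_map_iff {α β : Type*} {e : List α → List β}
    (he : Function.Injective e) (h_nil : e [] = []) (h_append : ∀ x y, e (x ++ y) = e x ++ e y)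
    (T : List (List α × List α)) :
    HasMatch (T.map (Prod.map e e)) ↔ HasMatch T := by
  have hfst : ∀ s : List (List α × List α),
      (s.map (Prod.map e e)).flatMap Prod.fst = e (s.flatMap Prod.fst) := by
    intro s
    induction s with
    | nil => simp [h_nil]
    | cons t s ih => simp [h_append, ih]
  have hsnd : ∀ s : List (List α × List α),
      (s.map (Prod.map e e)).flatMap Prod.snd = e (s.flatMap Prod.snd) := by
    intro s
    induction s with
    | nil => simp [h_nil]
    | cons t s ih => simp [h_append, ih]
  constructor
  · rintro ⟨s, hs, hT, h⟩
    obtain ⟨s, rfl⟩ : ∃ s' : List (List α × List α), s'.map (Prod.map e e) = s := by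
      have : s ∈ Set.range (List.map (Prod.map e e)) := by
        rw [Set.range_list_map]
        intro t ht
        obtain ⟨t', -, h'⟩ := List.mem_map.1 (hT t ht)
        exact ⟨t', h'⟩
      exact this
    have he2 : Function.Injective (Prod.map e e) := he.prodMap he
    refine ⟨s, by simpa using hs, fun t ht => ?_, he ?_⟩
    · exact (List.mem_map_of_injective he2).1 (hT _ (List.mem_map_of_mem ht))
    · rw [← hfst, ← hsnd, h]
  · rintro ⟨s, hs, hT, h⟩
    refine ⟨s.map (Prod.map e e), by simpa using hs, fun t ht => ?_, ?_⟩
    · obtain ⟨t', ht', rfl⟩ := List.mem_map.1 ht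
      exact List.mem_map_of_mem (hT _ ht')
    · rw [hfst, hsnd, h]

/-- Unary code words terminated by `false`. -/
def unaryCode (n : ℕ) : List Bool :=
  List.replicate n true ++ [false]

theorem unaryCode_append_inj {m n : ℕ} {x y : List Bool}
    (h : unaryCode m ++ x = unaryCode n ++ y) : m = n ∧ x = y := by
  induction m generalizing n with
  | zero => cases n <;> simp_all [unaryCode, List.replicate_succ]
  | succ m ih =>
    cases n with
    | zero => simp [unaryCode, List.replicate_succ] at h
    | succ n =>
      have := @ih n (by simpa [unaryCode, List.replicate_succ] using h)
      simpa using this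

theorem exists_injective_flatMap (α : Type*) [Finite α] :
    ∃ e : α → List Bool, Function.Injective (List.flatMap e) := by
  obtain ⟨n, ⟨f⟩⟩ := Finite.exists_equiv_fin α
  refine ⟨fun a => unaryCode (f a), fun x => ?_⟩
  induction x with
  | nil =>
    intro y h
    cases y with
    | nil => rfl
    | cons b y => simp [unaryCode] at h
  | cons a x ih =>
    intro y h
    cases y with
    | nil => simp [unaryCode] at h
    | cons b y =>
      rw [List.flatMap_cons, List.flatMap_cons] at h
      obtain ⟨h₁, h₂⟩ := unaryCode_append_inj h
      rw [f.injective (Fin.ext h₁), ih h₂]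

/-- One step of string rewriting with the rules `R`. -/
def Rewrites {α : Type*} (R : List (List α × List α)) (x y : List α) : Prop :=
  ∃ p u v s, (u, v) ∈ R ∧ x = p ++ u ++ s ∧ y = p ++ v ++ s

section Dominoes

variable {α : Type*}

/-- Dominoes use two disjoint copies of the letters of a rewriting system, each with a separator,
and the end marker `none`. -/
abbrev Mark (α : Type*) : Type _ :=
  Option (Bool × Option α)

/-- The copy of a word in the alphabet selected by `b`. -/
def mark (b : Bool) (w : List α) : List (Mark α) :=
  w.map fun a => some (b, some a)

/-- The separator belonging to the alphabet selected by `b`. -/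
def sep (b : Bool) : Mark α :=
  some (b, none)

theorem mark_append (b : Bool) (x y : List α) : mark b (x ++ y) = mark b x ++ mark b y :=
  List.map_append

/-- The domino that writes the initial word. -/
def startDomino (w : List α) : List (Mark α) × List (Mark α) :=
  ([none], none :: (mark false w ++ [sep false]))

/-- The dominoes that do not depend on the initial word. -/
def stepDominoes (R : List (List α × List α)) (h : α) : List (List (Mark α) × List (Mark α)) :=
  [false, true].flatMap fun b =>
    ([sep b], [sep !b]) :: ([some (b, some h), sep b, none], [none]) ::
      R.map fun r => (mark b r.1, mark (!b) r.2)

theorem mem_stepDominoes {R : List (List α × List α)} {h : α}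
    {t : List (Mark α) × List (Mark α)} :
    t ∈ stepDominoes R h ↔ ∃ b, t = ([sep b], [sep !b]) ∨
      t = ([some (b, some h), sep b, none], [none]) ∨
      ∃ u v, (u, v) ∈ R ∧ t = (mark b u, mark (!b) v) := by
  simp [stepDominoes, eq_comm, or_assoc]

theorem mark_append_eq {b : Bool} {u y : List α} {S T : List (Mark α)}
    (h : mark b u ++ S = mark b y ++ sep b :: T) :
    ∃ z, y = u ++ z ∧ S = mark b z ++ sep b :: T := by
  induction u generalizing y with
  | nil => exact ⟨y, rfl, h⟩
  | cons a u ih =>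
    cases y with
    | nil => simp [mark, sep] at h
    | cons c y =>
      simp only [mark, List.map_cons, List.cons_append, List.cons.injEq, Option.some.injEq,
        Prod.mk.injEq, true_and] at h
      obtain ⟨rfl, h⟩ := h
      obtain ⟨z, rfl, hz⟩ := ih h
      exact ⟨z, rfl, hz⟩

theorem reflTransGen_of_dominoes {R : List (List α × List α)} {h : α} {w : List α}
    (hR : ∀ r ∈ R, r.1 ≠ [] ∧ r.2 ≠ []) (s : List (List (Mark α) × List (Mark α)))
    (hs : ∀ t ∈ s, t ∈ startDomino w :: stepDominoes R h) (b : Bool) (x y : List α)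
    (heq : s.flatMap Prod.fst = mark b y ++ sep b :: (mark (!b) x ++ s.flatMap Prod.snd)) :
    ReflTransGen (Rewrites R) (x ++ y) [h] := by
  induction s generalizing b x y with
  | nil => simp at heq
  | cons t s ih =>
    have ih := ih fun t ht => hs t (List.mem_cons_of_mem _ ht)
    have ht := hs t List.mem_cons_self
    rw [List.flatMap_cons, List.flatMap_cons] at heq
    rcases List.mem_cons.1 ht with rfl | ht
    · cases y <;> simp [startDomino, mark, sep] at heq
    obtain ⟨c, rfl | rfl | ⟨u, v, huv, rfl⟩⟩ := mem_stepDominoes.1 ht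
    · cases y with
      | cons a y => simp [mark, sep] at heq
      | nil =>
        simp only [mark, sep, List.map_nil, List.nil_append, List.cons_append, List.cons.injEq,
          Option.some.injEq, Prod.mk.injEq, and_true] at heq
        obtain ⟨rfl, heq⟩ := heq
        simpa using ih (!c) [] x (by simpa [mark, sep] using heq)
    · cases y with
      | nil => simp [mark, sep] at heq
      | cons a y =>
        cases y with
        | cons a' y => simp [mark, sep] at heq
        | nil =>
          cases x with
          | cons a' x => simp [mark, sep] at heq
          | nil =>
            simp [mark, sep] at heq
            rw [heq.1.2]
            exact ReflTransGen.refl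
    · obtain rfl : c = b := by
        obtain ⟨a, u, rfl⟩ := List.exists_cons_of_ne_nil (hR _ huv).1
        cases y with
        | nil => simp [mark, sep] at heq
        | cons a' y =>
          simp only [mark, List.map_cons, List.cons_append, List.cons.injEq, Option.some.injEq,
            Prod.mk.injEq] at heq
          exact heq.1.1
      obtain ⟨z, rfl, hz⟩ := mark_append_eq heq
      refine ReflTransGen.head ⟨x, u, v, z, huv, by simp, rfl⟩ (ih c (x ++ v) z ?_)
      simpa [mark_append] using hz

theorem exists_dominoes_of_reflTransGen {R : List (List α × List α)} {h : α} {w : List α}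
    (hR : ∀ a, ([a], [a]) ∈ R) (hw : ReflTransGen (Rewrites R) w [h]) (b : Bool) :
    ∃ s : List (List (Mark α) × List (Mark α)), (∀ t ∈ s, t ∈ stepDominoes R h) ∧
      s.flatMap Prod.fst = mark b w ++ sep b :: s.flatMap Prod.snd := by
  induction hw using ReflTransGen.head_induction_on generalizing b with
  | refl =>
    refine ⟨[([some (b, some h), sep b, none], [none])], ?_, by simp [mark]⟩
    simp only [List.mem_singleton, forall_eq]
    exact mem_stepDominoes.2 ⟨b, Or.inr (Or.inl rfl)⟩
  | head hstep _ ih =>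
    obtain ⟨p, u, v, q, huv, rfl, rfl⟩ := hstep
    obtain ⟨s, hs, heq⟩ := ih (!b)
    have copy : ∀ w : List α, ∃ s : List (List (Mark α) × List (Mark α)),
        (∀ t ∈ s, t ∈ stepDominoes R h) ∧
          s.flatMap Prod.fst = mark b w ∧ s.flatMap Prod.snd = mark (!b) w := by
      intro w
      refine ⟨w.map fun a => (mark b [a], mark (!b) [a]), ?_, ?_, ?_⟩
      · intro t ht
        obtain ⟨a, -, rfl⟩ := List.mem_map.1 ht
        exact mem_stepDominoes.2 ⟨b, Or.inr (Or.inr ⟨_, _, hR a, rfl⟩)⟩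
      · induction w with
        | nil => rfl
        | cons a w ih => simpa [mark] using ih
      · induction w with
        | nil => rfl
        | cons a w ih => simpa [mark] using ih
    obtain ⟨sp, hsp, hp₁, hp₂⟩ := copy p
    obtain ⟨sq, hsq, hq₁, hq₂⟩ := copy q
    refine ⟨sp ++ (mark b u, mark (!b) v) :: (sq ++ ([sep b], [sep !b]) :: s), ?_, ?_⟩
    · intro t ht
      simp only [List.mem_append, List.mem_cons] at ht
      rcases ht with ht | rfl | ht | rfl | ht
      · exact hsp t ht
      · exact mem_stepDominoes.2 ⟨b, Or.inr (Or.inr ⟨_, _, huv, rfl⟩)⟩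
      · exact hsq t ht
      · exact mem_stepDominoes.2 ⟨b, Or.inl rfl⟩
      · exact hs t ht
    · simp [hp₁, hp₂, hq₁, hq₂, heq, mark_append]

/-- Post's reduction: rewriting `w` to the single letter `h` amounts to a domino match. -/
theorem hasMatch_dominoes_iff {R : List (List α × List α)} {h : α} {w : List α}
    (hcopy : ∀ a, ([a], [a]) ∈ R) (hR : ∀ r ∈ R, r.1 ≠ [] ∧ r.2 ≠ []) :
    HasMatch (startDomino w :: stepDominoes R h) ↔ ReflTransGen (Rewrites R) w [h] := by
  constructor
  · rintro ⟨s, hne, hs, heq⟩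
    obtain ⟨t, s, rfl⟩ := List.exists_cons_of_ne_nil hne
    have hs' := fun t ht => hs t (List.mem_cons_of_mem _ ht)
    rw [List.flatMap_cons, List.flatMap_cons] at heq
    rcases List.mem_cons.1 (hs t List.mem_cons_self) with rfl | ht
    · simpa using reflTransGen_of_dominoes hR s hs' false [] w
        (by simpa [startDomino, mark] using heq)
    obtain ⟨c, rfl | rfl | ⟨u, v, huv, rfl⟩⟩ := mem_stepDominoes.1 ht
    · simp [sep] at heq
    · simp at heq
    · obtain ⟨hu, hv⟩ := hR _ huv
      obtain ⟨a, u, rfl⟩ := List.exists_cons_of_ne_nil hu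
      obtain ⟨a', v, rfl⟩ := List.exists_cons_of_ne_nil hv
      simp [mark] at heq
  · intro hw
    obtain ⟨s, hs, heq⟩ := exists_dominoes_of_reflTransGen hcopy hw false
    refine ⟨startDomino w :: s, by simp, ?_, by simp [startDomino, heq]⟩
    intro t ht
    rcases List.mem_cons.1 ht with rfl | ht
    · exact List.mem_cons_self
    · exact List.mem_cons_of_mem _ (hs t ht)

end Dominoes

section Machine

open Turing StateTransition

variable {Γ Λ : Type*}

/-- Letters used to write down the configurations of a Turing machine. -/
inductive Letter (Γ Λ : Type*)
  | sym : Γ → Letter Γ Λ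
  | state : Λ → Letter Γ Λ
  | leftEnd : Letter Γ Λ
  | rightEnd : Letter Γ Λ
  | halted : Letter Γ Λ
  deriving Fintype

open Letter

/-- The rewriting rules simulating a Turing machine. The end markers can produce blanks, and the
letter `halted` appears when the machine halts and then erases all other letters. -/
inductive Rule [Inhabited Γ] [Inhabited Λ] (M : TM0.Machine Γ Λ) :
    List (Letter Γ Λ) → List (Letter Γ Λ) → Prop
  | copy (x) : Rule M [x] [x]
  | extendLeft : Rule M [leftEnd] [leftEnd, sym default]
  | extendRight : Rule M [rightEnd] [sym default, rightEnd]
  | write {q a q' b} (h : M q a = some (q', TM0.Stmt.write b)) :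
      Rule M [state q, sym a] [state q', sym b]
  | moveLeft {q a q'} (b) (h : M q a = some (q', TM0.Stmt.move Dir.left)) :
      Rule M [sym b, state q, sym a] [state q', sym b, sym a]
  | moveRight {q a q'} (h : M q a = some (q', TM0.Stmt.move Dir.right)) :
      Rule M [state q, sym a] [sym a, state q']
  | halt {q a} (h : M q a = none) : Rule M [state q, sym a] [halted]
  | eraseLeft (a) : Rule M [sym a, halted] [halted]
  | eraseRight (a) : Rule M [halted, sym a] [halted]
  | eraseLeftEnd : Rule M [leftEnd, halted] [halted]
  | eraseRightEnd : Rule M [halted, rightEnd] [halted]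

theorem exists_list_rule [Inhabited Γ] [Inhabited Λ] [Finite Γ] [Finite Λ]
    (M : TM0.Machine Γ Λ) :
    ∃ R : List (List (Letter Γ Λ) × List (Letter Γ Λ)), ∀ u v, (u, v) ∈ R ↔ Rule M u v := by
  have := Fintype.ofFinite Γ
  have := Fintype.ofFinite Λ
  have hfin : {r : List (Letter Γ Λ) × List (Letter Γ Λ) | Rule M r.1 r.2}.Finite := by
    refine ((List.finite_length_le (Letter Γ Λ) 3).prod
      (List.finite_length_le (Letter Γ Λ) 3)).subset ?_
    rintro ⟨u, v⟩ h
    change Rule M u v at h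
    cases h <;> simp
  exact ⟨hfin.toFinset.toList, fun u v => by simp⟩

/-- The word describing a configuration: `l` is the part of the tape left of the head, read
leftwards, and `r` is the remaining part. -/
def configWord (l : List Γ) (q : Λ) (r : List Γ) : List (Letter Γ Λ) :=
  leftEnd :: (l.reverse.map sym ++ state q :: (r.map sym ++ [rightEnd]))

/-- The configuration described by `configWord`. -/
def config [Inhabited Γ] (l : List Γ) (q : Λ) (r : List Γ) : TM0.Cfg Γ Λ :=
  ⟨q, Tape.mk' (ListBlank.mk l) (ListBlank.mk r)⟩

theorem listBlank_mk_append_default [Inhabited Γ] (l : List Γ) :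
    ListBlank.mk (l ++ [default]) = ListBlank.mk l :=
  Eq.symm (Quotient.sound' (Or.inl ⟨1, rfl⟩))

/-- A list splits in only one way around a letter that satisfies `P` and is the only one to do
so in one of the splittings. -/
theorem append_cons_inj_of_unique {α : Type*} (P : α → Prop) {a b c d : List α} {x y : α}
    (hx : P x) (hc : ∀ z ∈ c, ¬ P z) (hd : ∀ z ∈ d, ¬ P z)
    (h : a ++ x :: b = c ++ y :: d) : a = c ∧ x = y ∧ b = d := by
  rcases List.append_eq_append_iff.1 h with ⟨e, rfl, he⟩ | ⟨e, rfl, he⟩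
  · cases e with
    | nil => simpa using he
    | cons z e =>
      simp only [List.cons_append, List.cons.injEq] at he
      exact absurd hx (hc x (by simp [he.1]))
  · cases e with
    | nil => simpa [eq_comm] using he
    | cons z e =>
      simp only [List.cons_append, List.cons.injEq] at he
      exact absurd hx (hd x (by simp [he.2]))

/-- Recognizes state letters. -/
def Letter.IsState : Letter Γ Λ → Prop
  | state _ => True
  | _ => False

theorem append_state_eq_configWord {p s : List (Letter Γ Λ)} {l r : List Γ} {q q' : Λ}
    (h : p ++ state q' :: s = configWord l q r) :
    p = leftEnd :: l.reverse.map sym ∧ q' = q ∧ s = r.map sym ++ [rightEnd] := by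
  have := append_cons_inj_of_unique Letter.IsState (x := state q') (by trivial)
    (c := leftEnd :: l.reverse.map sym) (d := r.map sym ++ [rightEnd])
    (by intro z; cases z <;> simp [Letter.IsState])
    (by intro z; cases z <;> simp [Letter.IsState]) h
  simpa using this

theorem cons_sym_eq {s : List (Letter Γ Λ)} {a : Γ} {r : List Γ}
    (h : sym a :: s = r.map sym ++ [rightEnd]) :
    ∃ r', r = a :: r' ∧ s = r'.map sym ++ [rightEnd] := by
  cases r with
  | nil => simp at h
  | cons b r =>
    simp only [List.map_cons, List.cons_append, List.cons.injEq, Letter.sym.injEq] at h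
    exact ⟨r, by rw [h.1], h.2⟩

variable [Inhabited Γ] [Inhabited Λ]

theorem step_config_cons (M : TM0.Machine Γ Λ) (l r : List Γ) (q : Λ) (a : Γ) :
    TM0.step M (config l q (a :: r)) = (M q a).map fun p => match p.2 with
      | TM0.Stmt.move Dir.left => config l.tail p.1 (l.headI :: a :: r)
      | TM0.Stmt.move Dir.right => config (a :: l) p.1 r
      | TM0.Stmt.write b => config l p.1 (b :: r) := by
  simp only [TM0.step, config, Tape.mk'_head, ListBlank.head_mk, List.headI_cons]
  rcases M q a with _ | ⟨q', (_ | _) | b⟩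
  · rfl
  · simp [Tape.move_left_mk']
  · simp [Tape.move_right_mk']
  · simp [Tape.write_mk']

theorem rewrites_configWord {M : TM0.Machine Γ Λ} {R : List (List (Letter Γ Λ) × List (Letter Γ Λ))}
    (hR : ∀ u v, (u, v) ∈ R ↔ Rule M u v) {l r : List Γ} {q : Λ} {w : List (Letter Γ Λ)}
    (h : Rewrites R (configWord l q r) w) :
    TM0.step M (config l q r) = none ∨ ∃ l' q' r', w = configWord l' q' r' ∧
      Reaches (TM0.step M) (config l q r) (config l' q' r') := by
  obtain ⟨p, u, v, s, huv, h, rfl⟩ := h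
  have no_halted : halted ∉ configWord l q r := by simp [configWord]
  cases (hR u v).1 huv with
  | copy => exact Or.inr ⟨l, q, r, h.symm, ReflTransGen.refl⟩
  | extendLeft =>
    obtain ⟨rfl, -, rfl⟩ := append_cons_inj_of_unique (· = leftEnd) (x := leftEnd) rfl
      (c := []) (d := l.reverse.map sym ++ state q :: (r.map sym ++ [rightEnd]))
      (by intro z; cases z <;> simp) (by intro z; cases z <;> simp)
      (by simpa [configWord] using h.symm)
    refine Or.inr ⟨l ++ [default], q, r, by simp [configWord], ?_⟩
    rw [config, config, listBlank_mk_append_default]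
    exact ReflTransGen.refl
  | extendRight =>
    obtain ⟨rfl, -, rfl⟩ := append_cons_inj_of_unique (· = rightEnd) (x := rightEnd) rfl
      (c := leftEnd :: (l.reverse.map sym ++ state q :: r.map sym)) (d := [])
      (by intro z; cases z <;> simp) (by intro z; cases z <;> simp)
      (by simpa [configWord] using h.symm)
    refine Or.inr ⟨l, q, r ++ [default], by simp [configWord], ?_⟩
    rw [config, config, listBlank_mk_append_default]
    exact ReflTransGen.refl
  | @write q₁ a q' b hM =>
    obtain ⟨rfl, rfl, hs⟩ := append_state_eq_configWord (by simpa using h.symm)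
    obtain ⟨r, rfl, rfl⟩ := cons_sym_eq hs
    exact Or.inr ⟨l, q', b :: r, by simp [configWord],
      ReflTransGen.single (by simp [step_config_cons, hM])⟩
  | @moveLeft q₁ a q' b hM =>
    obtain ⟨hp, rfl, hs⟩ := append_state_eq_configWord (p := p ++ [sym b]) (by simpa using h.symm)
    obtain ⟨r, rfl, rfl⟩ := cons_sym_eq hs
    cases l with
    | nil => simp [List.append_eq_cons_iff] at hp
    | cons c l =>
      obtain ⟨rfl, hb⟩ := List.append_inj' (s₁ := p) (t₁ := [sym b])
        (s₂ := leftEnd :: l.reverse.map sym) (t₂ := [sym c]) (by simpa using hp) rfl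
      obtain rfl : b = c := by simpa using hb
      exact Or.inr ⟨l, q', b :: a :: r, by simp [configWord],
        ReflTransGen.single (by simp [step_config_cons, hM])⟩
  | @moveRight q₁ a q' hM =>
    obtain ⟨rfl, rfl, hs⟩ := append_state_eq_configWord (by simpa using h.symm)
    obtain ⟨r, rfl, rfl⟩ := cons_sym_eq hs
    exact Or.inr ⟨a :: l, q', r, by simp [configWord],
      ReflTransGen.single (by simp [step_config_cons, hM])⟩
  | @halt q₁ a hM =>
    obtain ⟨rfl, rfl, hs⟩ := append_state_eq_configWord (by simpa using h.symm)
    obtain ⟨r, rfl, rfl⟩ := cons_sym_eq hs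
    exact Or.inl (by simp [step_config_cons, hM])
  | eraseLeft | eraseRight | eraseLeftEnd | eraseRightEnd =>
    exact absurd (by simp [h]) no_halted

theorem eval_dom_of_rewrites {M : TM0.Machine Γ Λ}
    {R : List (List (Letter Γ Λ) × List (Letter Γ Λ))}
    (hR : ∀ u v, (u, v) ∈ R ↔ Rule M u v) {w : List (Letter Γ Λ)}
    (h : ReflTransGen (Rewrites R) w [halted]) (l : List Γ) (q : Λ) (r : List Γ)
    (hw : w = configWord l q r) : (eval (TM0.step M) (config l q r)).Dom := by
  induction h using ReflTransGen.head_induction_on generalizing l q r with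
  | refl => simp [configWord] at hw
  | head hstep _ ih =>
    subst hw
    rcases rewrites_configWord hR hstep with h | ⟨l', q', r', rfl, h⟩
    · exact Part.dom_iff_mem.2 ⟨_, mem_eval.2 ⟨ReflTransGen.refl, h⟩⟩
    · rw [reaches_eval h]
      exact ih l' q' r' rfl

theorem Rule.rewrites {M : TM0.Machine Γ Λ} {R : List (List (Letter Γ Λ) × List (Letter Γ Λ))}
    (hR : ∀ u v, (u, v) ∈ R ↔ Rule M u v) {u v x y : List (Letter Γ Λ)} (h : Rule M u v)
    (p s : List (Letter Γ Λ)) (hx : x = p ++ u ++ s) (hy : y = p ++ v ++ s) :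
    ReflTransGen (Rewrites R) x y :=
  ReflTransGen.single ⟨p, u, v, s, (hR u v).2 h, hx, hy⟩

theorem rewrites_erase {M : TM0.Machine Γ Λ} {R : List (List (Letter Γ Λ) × List (Letter Γ Λ))}
    (hR : ∀ u v, (u, v) ∈ R ↔ Rule M u v) (l r : List Γ) :
    ReflTransGen (Rewrites R)
      (leftEnd :: (l.reverse.map sym ++ halted :: (r.map sym ++ [rightEnd]))) [halted] := by
  induction l with
  | cons a l ih =>
    exact ((Rule.eraseLeft a).rewrites hR (leftEnd :: l.reverse.map sym)
      (r.map sym ++ [rightEnd]) (by simp) (by simp)).trans ih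
  | nil =>
    refine ((Rule.eraseLeftEnd).rewrites hR [] (r.map sym ++ [rightEnd])
      (y := halted :: (r.map sym ++ [rightEnd])) (by simp) (by simp)).trans ?_
    induction r with
    | cons a r ih =>
      exact ((Rule.eraseRight a).rewrites hR [] (r.map sym ++ [rightEnd])
        (by simp) (by simp)).trans ih
    | nil => exact (Rule.eraseRightEnd).rewrites hR [] [] (by simp) (by simp)

theorem rewrites_of_reaches {M : TM0.Machine Γ Λ}
    {R : List (List (Letter Γ Λ) × List (Letter Γ Λ))}
    (hR : ∀ u v, (u, v) ∈ R ↔ Rule M u v) {c d : TM0.Cfg Γ Λ}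
    (h : Reaches (TM0.step M) c d) (hd : TM0.step M d = none) (l : List Γ) (q : Λ) (r : List Γ)
    (hc : c = config l q r) : ReflTransGen (Rewrites R) (configWord l q r) [halted] := by
  induction h using ReflTransGen.head_induction_on generalizing l q r with
  | refl =>
    subst hc
    wlog hr : r ≠ [] generalizing r
    · obtain rfl : r = [] := by simpa using hr
      have hblank : config l q ([] : List Γ) = config l q [default] := by
        rw [config, config, ← listBlank_mk_append_default []]; rfl
      exact (Rule.extendRight.rewrites hR (leftEnd :: (l.reverse.map sym ++ [state q])) []
        (by simp [configWord]) (by simp [configWord])).trans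
          (this [default] (hblank ▸ hd) (by simp))
    obtain ⟨a, r, rfl⟩ := List.exists_cons_of_ne_nil hr
    have hM : M q a = none := by simpa [step_config_cons] using hd
    exact ((Rule.halt hM).rewrites hR (leftEnd :: l.reverse.map sym) (r.map sym ++ [rightEnd])
      (by simp [configWord]) (by simp)).trans (rewrites_erase hR l r)
  | head hstep _ ih =>
    subst hc
    wlog hr : r ≠ [] generalizing r
    · obtain rfl : r = [] := by simpa using hr
      have hblank : config l q ([] : List Γ) = config l q [default] := by
        rw [config, config, ← listBlank_mk_append_default []]; rfl
      exact (Rule.extendRight.rewrites hR (leftEnd :: (l.reverse.map sym ++ [state q])) []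
        (by simp [configWord]) (by simp [configWord])).trans
          (this [default] (hblank ▸ hstep) (by simp))
    obtain ⟨a, r, rfl⟩ := List.exists_cons_of_ne_nil hr
    wlog hl : l ≠ [] generalizing l
    · obtain rfl : l = [] := by simpa using hl
      have hblank : config ([] : List Γ) q (a :: r) = config [default] q (a :: r) := by
        rw [config, config, ← listBlank_mk_append_default []]; rfl
      exact (Rule.extendLeft.rewrites hR [] (state q :: ((a :: r).map sym ++ [rightEnd]))
        (by simp [configWord]) (by simp [configWord])).trans
          (this [default] (hblank ▸ hstep) (by simp))
    obtain ⟨b, l, rfl⟩ := List.exists_cons_of_ne_nil hl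
    rw [step_config_cons] at hstep
    obtain ⟨⟨q', stmt⟩, hM, rfl⟩ := Option.map_eq_some_iff.1 hstep
    rcases stmt with (_ | _) | a'
    · exact ((Rule.moveLeft b hM).rewrites hR (leftEnd :: l.reverse.map sym)
        (r.map sym ++ [rightEnd]) (by simp [configWord]) (by simp [configWord])).trans
          (ih l q' (b :: a :: r) rfl)
    · exact ((Rule.moveRight hM).rewrites hR (leftEnd :: (b :: l).reverse.map sym)
        (r.map sym ++ [rightEnd]) (by simp [configWord]) (by simp [configWord])).trans
          (ih (a :: b :: l) q' r rfl)
    · exact ((Rule.write hM).rewrites hR (leftEnd :: (b :: l).reverse.map sym)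
        (r.map sym ++ [rightEnd]) (by simp [configWord]) (by simp [configWord])).trans
          (ih (b :: l) q' (a' :: r) rfl)

/-- The machine halts on `r` if and only if its initial word rewrites to `halted`. -/
theorem rewrites_halted_iff {M : TM0.Machine Γ Λ}
    {R : List (List (Letter Γ Λ) × List (Letter Γ Λ))}
    (hR : ∀ u v, (u, v) ∈ R ↔ Rule M u v) (r : List Γ) :
    ReflTransGen (Rewrites R) (configWord [] default r) [halted] ↔ (TM0.eval M r).Dom := by
  constructor
  · exact fun h => eval_dom_of_rewrites hR h [] default r rfl
  · intro h
    obtain ⟨d, hd⟩ := Part.dom_iff_mem.1 (show (eval (TM0.step M) (TM0.init r)).Dom from h)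
    obtain ⟨hreach, hnone⟩ := mem_eval.1 hd
    exact rewrites_of_reaches hR hreach hnone [] default r rfl

end Machine

section Partrec

open Turing

/-- A machine supported on a finite set of states can be replaced by one with finitely many
states. -/
theorem exists_finite_states {Γ Λ : Type} [Inhabited Γ] [Inhabited Λ] (M : TM0.Machine Γ Λ)
    (S : Set Λ) (hS : S.Finite) (ss : TM0.Supports M S) :
    ∃ (Λ' : Type) (_ : Inhabited Λ') (_ : Finite Λ') (M' : TM0.Machine Γ Λ'),
      ∀ l, (TM0.eval M' l).Dom ↔ (TM0.eval M l).Dom := by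
  classical
  let inst : Inhabited S := ⟨⟨default, ss.1⟩⟩
  let g : PointedMap Λ S := ⟨fun q => if h : q ∈ S then ⟨q, h⟩ else default, dif_pos ss.1⟩
  let i : PointedMap Γ Γ := ⟨id, rfl⟩
  refine ⟨S, inst, hS, M.map i i g Subtype.val, fun l => ?_⟩
  have hg : ∀ q ∈ S, (g q : Λ) = q := fun q hq => congrArg Subtype.val (dif_pos hq)
  have hresp := TM0.Machine.map_respects M i i g Subtype.val ss (fun _ => rfl) hg
  have hinit : (TM0.init l : TM0.Cfg Γ Λ).map i g = TM0.init l := by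
    rw [TM0.map_init]
    exact congrArg TM0.init (List.map_id l)
  exact StateTransition.tr_eval_dom hresp ⟨ss.1, hinit⟩

theorem trPosNum_two_pow (n : ℕ) :
    PartrecToTM2.trPosNum (PosNum.bit0^[n] PosNum.one) =
      List.replicate n PartrecToTM2.Γ'.bit0 ++ [PartrecToTM2.Γ'.bit1] := by
  induction n with
  | zero => rfl
  | succ n ih =>
    rw [Function.iterate_succ_apply', PartrecToTM2.trPosNum, ih, List.replicate_succ,
      List.cons_append]

theorem num_two_pow (n : ℕ) : ((2 ^ n : ℕ) : Num) = Num.pos (PosNum.bit0^[n] PosNum.one) := by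
  apply Num.to_nat_inj.1
  rw [Num.to_of_nat, Num.cast_pos]
  induction n with
  | zero => rfl
  | succ n ih =>
    rw [Function.iterate_succ_apply', PosNum.cast_bit0, ← ih, pow_succ, mul_two]

theorem trList_two_pow (n : ℕ) :
    PartrecToTM2.trList [2 ^ n] = List.replicate n PartrecToTM2.Γ'.bit0 ++
      [PartrecToTM2.Γ'.bit1, PartrecToTM2.Γ'.cons] := by
  rw [PartrecToTM2.trList, PartrecToTM2.trNat, num_two_pow, PartrecToTM2.trNum,
    trPosNum_two_pow]
  simp [PartrecToTM2.trList]

/-- A partial recursive function, restricted to powers of two, is computed by a Turing machine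
with finitely many states. -/
theorem exists_machine (c : ToPartrec.Code) :
    ∃ (Γ Λ : Type) (_ : Inhabited Γ) (_ : Inhabited Λ) (_ : Finite Γ) (_ : Finite Λ)
      (M : TM0.Machine Γ Λ) (x y z : Γ),
      ∀ n, (TM0.eval M (x :: y :: List.replicate n z)).Dom ↔ (c.eval [2 ^ n]).Dom := by
  classical
  let inst : Inhabited PartrecToTM2.Λ' := ⟨PartrecToTM2.trNormal c PartrecToTM2.Cont'.halt⟩
  have ss₂ : TM2.Supports PartrecToTM2.tr _ := PartrecToTM2.tr_supports c PartrecToTM2.Cont'.halt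
  have ss₀ := TM1to0.tr_supports _ (TM2to1.tr_supports _ ss₂)
  obtain ⟨Λ, iΛ, fΛ, M, hM⟩ := exists_finite_states _ _ (Finset.finite_toSet _) ss₀
  have hK : Finite PartrecToTM2.K' := Set.finite_univ_iff.1 <|
    (Set.toFinite {PartrecToTM2.K'.main, .rev, .aux, .stack}).subset fun k _ => by
      cases k <;> simp
  have hΓ : Finite (TM2to1.Γ' PartrecToTM2.K' fun _ => PartrecToTM2.Γ') :=
    (inferInstance : Finite (Bool × (PartrecToTM2.K' → Option PartrecToTM2.Γ')))
  refine ⟨TM2to1.Γ' PartrecToTM2.K' fun _ => PartrecToTM2.Γ', Λ, inferInstance, iΛ, hΓ, fΛ, M,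
    (true, Function.update (fun _ => none) PartrecToTM2.K'.main (some PartrecToTM2.Γ'.cons)),
    (false, Function.update (fun _ => none) PartrecToTM2.K'.main (some PartrecToTM2.Γ'.bit1)),
    (false, Function.update (fun _ => none) PartrecToTM2.K'.main (some PartrecToTM2.Γ'.bit0)),
    fun n => ?_⟩
  have htr := TM2to1.tr_eval_dom PartrecToTM2.tr PartrecToTM2.K'.main
    (PartrecToTM2.trList [2 ^ n])
  rw [hM, TM1to0.tr_eval]
  have hinit : TM2to1.trInit PartrecToTM2.K'.main (PartrecToTM2.trList [2 ^ n]) =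
      ((true, Function.update (fun _ => none) PartrecToTM2.K'.main (some PartrecToTM2.Γ'.cons)) ::
      (false, Function.update (fun _ => none) PartrecToTM2.K'.main (some PartrecToTM2.Γ'.bit1)) ::
      List.replicate n (false, Function.update (fun _ => none) PartrecToTM2.K'.main
        (some PartrecToTM2.Γ'.bit0)) :
        List (TM2to1.Γ' PartrecToTM2.K' fun _ => PartrecToTM2.Γ')) := by
    rw [TM2to1.trInit, trList_two_pow, List.reverse_append, List.reverse_replicate]
    exact congrArg (fun t => _ :: _ :: t) List.map_replicate
  rw [← hinit, htr]
  have hcfg : (TM2.init PartrecToTM2.K'.main (PartrecToTM2.trList [2 ^ n]) :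
      PartrecToTM2.Cfg') = PartrecToTM2.init c [2 ^ n] := by
    simp only [TM2.init, PartrecToTM2.init]
    congr 1
    funext k
    cases k <;> rfl
  change (StateTransition.eval (TM2.step PartrecToTM2.tr)
    (TM2.init PartrecToTM2.K'.main (PartrecToTM2.trList [2 ^ n]))).Dom ↔ _
  rw [hcfg, PartrecToTM2.tr_eval]
  rfl

end Partrec

/-- There is a Turing machine whose halting problem is undecidable already for the inputs of the
form `x y z z … z`. -/
theorem exists_machine_halting :
    ∃ (Γ Λ : Type) (_ : Inhabited Γ) (_ : Inhabited Λ) (_ : Finite Γ) (_ : Finite Λ)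
      (M : Turing.TM0.Machine Γ Λ) (x y z : Γ),
      ¬ ComputablePred fun n : ℕ => (Turing.TM0.eval M (x :: y :: List.replicate n z)).Dom := by
  let f : ℕ →. ℕ := fun m => (Nat.rfind fun k => Part.some (decide (2 ^ k = m))).bind
    fun n => (Denumerable.ofNat Nat.Partrec.Code n).eval 0
  have hpow : Primrec₂ fun a b : ℕ => a ^ b := by
    refine (Primrec.nat_rec (f := fun _ : ℕ => 1) (g := fun a p => p.2 * a)
      (Primrec.const 1) ?_).of_eq fun a b => ?_
    · exact Primrec.nat_mul.comp (Primrec.snd.comp Primrec.snd) Primrec.fst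
    · induction b with
      | zero => rfl
      | succ b ih => rw [pow_succ, ← ih]
  have hf : Partrec f := by
    refine Partrec.bind (Partrec.rfind ?_) ?_
    · refine (Primrec.to_comp (α := ℕ × ℕ) (f := fun p => decide (2 ^ p.2 = p.1)) ?_).partrec
      exact (Primrec.eq (α := ℕ)).decide.comp (hpow.comp (Primrec.const 2) Primrec.snd)
        Primrec.fst
    · exact Nat.Partrec.Code.eval_part.comp ((Computable.ofNat _).comp Computable.snd)
        (Computable.const 0)
  have hf_pow : ∀ n, f (2 ^ n) = (Denumerable.ofNat Nat.Partrec.Code n).eval 0 := by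
    intro n
    have hn : Nat.rfind (fun k => Part.some (decide (2 ^ k = 2 ^ n))) = Part.some n := by
      refine Part.eq_some_iff.2 (Nat.mem_rfind.2 ⟨by simp, fun {m} hm => ?_⟩)
      simpa using hm.ne
    simp only [f, hn, Part.bind_some]
  obtain ⟨c, hc⟩ := Turing.ToPartrec.Code.exists_code (Nat.Partrec'.part_iff₁.2 hf)
  obtain ⟨Γ, Λ, iΓ, iΛ, fΓ, fΛ, M, x, y, z, hM⟩ := exists_machine c
  refine ⟨Γ, Λ, iΓ, iΛ, fΓ, fΛ, M, x, y, z, fun h => ?_⟩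
  obtain ⟨g, hg, hspec⟩ := ComputablePred.computable_iff.1 h
  refine ComputablePred.halting_problem 0 (ComputablePred.computable_iff.2
    ⟨fun d => g (Encodable.encode d), hg.comp Computable.encode, funext fun d => ?_⟩)
  rw [← congrFun hspec (Encodable.encode d), hM, hc ⟨[2 ^ Encodable.encode d], rfl⟩]
  change _ = (f (2 ^ Encodable.encode d)).Dom
  rw [hf_pow, Denumerable.ofNat_encode]

theorem not_computable_hasMatch (f : List (List Bool × List Bool) → Bool) (hf : Computable f)
    (hspec : ∀ l, f l = true ↔ HasMatch l) : False := by
  obtain ⟨Γ, Λ, _, _, _, _, M, x, y, z, hM⟩ := exists_machine_halting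
  have := Fintype.ofFinite Γ
  have := Fintype.ofFinite Λ
  obtain ⟨R, hR⟩ := exists_list_rule M
  obtain ⟨e, he⟩ := exists_injective_flatMap (Mark (Letter Γ Λ))
  have hR_ne : ∀ r ∈ R, r.1 ≠ [] ∧ r.2 ≠ [] := by
    rintro ⟨u, v⟩ hr
    cases (hR u v).1 hr <;> simp
  let enc := Prod.map (List.flatMap e) (List.flatMap e)
  let w : ℕ → List (Letter Γ Λ) := fun n => configWord [] default (x :: y :: List.replicate n z)
  let T : ℕ → List (List Bool × List Bool) := fun n =>
    (startDomino (w n) :: stepDominoes R Letter.halted).map enc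
  have hT : ∀ n, HasMatch (T n) ↔
      (Turing.TM0.eval M (x :: y :: List.replicate n z)).Dom := by
    intro n
    rw [hasMatch_map_iff he rfl (fun a b => List.flatMap_append),
      hasMatch_dominoes_iff (fun a => (hR _ _).2 (Rule.copy a)) hR_ne, rewrites_halted_iff hR]
  have hT_comp : Computable T := by
    obtain ⟨A, B, C, hABC⟩ : ∃ A B C : List Bool, ∀ n,
        List.flatMap e (startDomino (w n)).2 = A ++ Nat.rec C (fun _ s => B ++ s) n := by
      refine ⟨List.flatMap e (none :: mark false [.leftEnd, .state default, .sym x, .sym y]),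
        e (some (false, some (.sym z))),
        List.flatMap e (mark false [.rightEnd] ++ [sep false]), fun n => ?_⟩
      have hrep : List.flatMap e (mark false (List.replicate n (Letter.sym z) ++ [.rightEnd]) ++
          [sep false]) = Nat.rec (List.flatMap e (mark false [.rightEnd] ++ [sep false]))
            (fun _ s => e (some (false, some (.sym z))) ++ s) n := by
        induction n with
        | zero => rfl
        | succ n ih =>
          change _ = e _ ++ Nat.rec _ _ n
          rw [← ih]
          rfl
      rw [← hrep, ← List.flatMap_append]
      simp [w, startDomino, configWord, mark]
    have hrec : Primrec fun n : ℕ => (Nat.rec C (fun _ s => B ++ s) n : List Bool) :=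
      Primrec.nat_rec₁ C (Primrec.list_append.comp (Primrec.const B) Primrec.snd)
    refine (Primrec.list_cons.comp (Primrec.pair (Primrec.const (List.flatMap e [none]))
      (Primrec.list_append.comp (Primrec.const A) hrec))
      (Primrec.const ((stepDominoes R Letter.halted).map enc))).to_comp.of_eq fun n => ?_
    rw [← hABC]
    rfl
  refine hM (ComputablePred.computable_iff.2 ⟨fun n => f (T n), hf.comp hT_comp, ?_⟩)
  funext n
  exact propext ((hT n).symm.trans (hspec _).symm)

end PCP

/-- Post's Correspondence Problem over the binary alphabet is
undecidable: no computable function decides, given a finite list of pairs of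
binary strings, whether a nonempty matching index sequence exists. -/
theorem pcp_undecidable :
    ¬ ∃ f : List (List Bool × List Bool) → Bool, Computable f ∧
      ∀ l : List (List Bool × List Bool),
        f l = true ↔
          ∃ idx : List (Fin l.length), idx ≠ [] ∧
            (idx.map fun i => (l.get i).1).flatten =
            (idx.map fun i => (l.get i).2).flatten := by
  rintro ⟨f, hf, hspec⟩
  exact PCP.not_computable_hasMatch f hf fun l => (hspec l).trans
    (PCP.hasMatch_iff_exists_index l).symm
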